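/- The H²-matrix–vector multiplication algorithm is correct: if G agrees with V_t S_b W_s* on every admissible leaf b = (t,s) and with its stored dense blocks on inadmissible leaves, then the composition of forward transformation, multiplication phase (ŷ_t += α S_b x̂_s on admissible leaves, y|_t̂ += α G|_{t̂×ŝ} x|_ŝ on inadmissible leaves), and backward transformation computes y + α G x. -/

import Mathlib

variable {I : Type} [DecidableEq I]

inductive CTree (I : Type) where
  | node : Finset I → List (CTree I) → CTree I

namespace CTree

def label : CTree I → Finset I
  | node l _ => l

def sonsOf : CTree I → List (CTree I)
  | node _ s => s

def leaves : CTree I → List (Finset I)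
  | node l [] => [l]
  | node _ (s :: ss) => (s :: ss).attach.flatMap fun c => c.1.leaves
decreasing_by
  have h := List.sizeOf_lt_of_mem c.2
  simp at h ⊢
  omega

inductive Valid : CTree I → Prop where
  | leaf : ∀ l, Valid (node l [])
  | internal : ∀ l sons, sons ≠ [] →
      l = sons.foldr (fun s acc => s.label ∪ acc) ∅ →
      sons.Pairwise (fun a b => Disjoint a.label b.label) →
      (∀ s ∈ sons, Valid s) → Valid (node l sons)

inductive Subtree : CTree I → CTree I → Prop where
  | refl : ∀ t, Subtree t t
  | son : ∀ {t s : CTree I} {l : Finset I} {sons : List (CTree I)},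
      s ∈ sons → Subtree t s → Subtree t (node l sons)

end CTree

variable {I : Type} [DecidableEq I] [Fintype I] {k : ℕ}

namespace CTree

/-- Forward transformation: recursively computes the transformed coefficient vectors
`x̂_s`. At a leaf, `x̂_s := W_s* x|_ŝ`; at an internal node,
`x̂_s := Σ_{s' ∈ sons(s)} E_{s'}* x̂_{s'}`. -/
noncomputable def forward (W : CTree I → Matrix I (Fin k) ℂ)
    (E : CTree I → Matrix (Fin k) (Fin k) ℂ) (x : I → ℂ) : CTree I → Fin k → ℂ
  | node l [] =>
      (W (node l [])).conjTranspose.mulVec (fun i => if i ∈ l then x i else 0)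
  | node _ (s :: ss) =>
      ((s :: ss).attach.map
        (fun c => (E c.1).conjTranspose.mulVec (forward W E x c.1))).sum
decreasing_by
  have h := List.sizeOf_lt_of_mem c.2
  simp at h ⊢
  omega

/-- Backward transformation: given the coefficient vectors `ŷ` and the accumulated
coefficient `c` at the current node, at an internal node it adds `E_{t'} c` to
`ŷ_{t'}` and recurses; at a leaf it returns the (zero-padded) vector `V_t c`.
The result is the total contribution added to the output vector `y`. -/
noncomputable def backward (V : CTree I → Matrix I (Fin k) ℂ)
    (E : CTree I → Matrix (Fin k) (Fin k) ℂ) (yhat : CTree I → Fin k → ℂ) :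
    CTree I → (Fin k → ℂ) → I → ℂ
  | node l [], c => (V (node l [])).mulVec c
  | node _ (s :: ss), c =>
      ((s :: ss).attach.map
        (fun d => backward V E yhat d.1 (yhat d.1 + (E d.1).mulVec c))).sum
decreasing_by
  have h := List.sizeOf_lt_of_mem d.2
  simp at h ⊢
  omega

/-- The list of all nodes of a tree. -/
def nodesList : CTree I → List (CTree I)
  | node l ss => node l ss :: ss.attach.flatMap (fun s => nodesList s.1)
decreasing_by
  have h := List.sizeOf_lt_of_mem s.2
  simp at h ⊢
  omega

end CTree

attribute [local instance] Classical.propDecidable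

open CTree in
/-- The coefficient vectors `ŷ_t` produced by the multiplication phase: for each
admissible leaf block `b = (t, s)` the contribution `α S_b x̂_s` is added to `ŷ_t`. -/
noncomputable def yhatOf {I J : Type} {k : ℕ}
    (L : List (CTree I × CTree J × Bool))
    (S : CTree I → CTree J → Matrix (Fin k) (Fin k) ℂ)
    (xhat : CTree J → Fin k → ℂ) (α : ℂ) (t : CTree I) : Fin k → ℂ :=
  (L.map (fun b => if b.1 = t ∧ b.2.2 = true
      then α • (S b.1 b.2.1).mulVec (xhat b.2.1) else 0)).sum

section Helpers

open CTree

variable {K : Type} [DecidableEq K]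

theorem h2_mem_foldr (sons : List (CTree K)) (i : K) :
    i ∈ sons.foldr (fun s acc => s.label ∪ acc) ∅ ↔ ∃ d ∈ sons, i ∈ d.label := by
  induction sons with
  | nil => simp
  | cons a l ih => simp [ih]

theorem h2_sub_sizeOf {t u : CTree K} (h : t.Subtree u) : sizeOf t ≤ sizeOf u := by
  induction h with
  | refl => exact le_rfl
  | son hs _ ih =>
    have h := List.sizeOf_lt_of_mem hs
    simp
    omega

theorem h2_sub_trans {t u v : CTree K} (h1 : t.Subtree u) (h2 : u.Subtree v) :
    t.Subtree v := by
  induction h2 with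
  | refl => exact h1
  | son hs _ ih => exact Subtree.son hs ih

theorem h2_sub_valid {t u : CTree K} (hu : u.Valid) (h : t.Subtree u) : t.Valid := by
  induction h with
  | refl => exact hu
  | son hs _ ih =>
    cases hu with
    | leaf => simp at hs
    | internal _ _ _ _ _ hv => exact ih (hv _ hs)

theorem h2_label_subset {t u : CTree K} (hu : u.Valid) (h : t.Subtree u) :
    ∀ i ∈ t.label, i ∈ u.label := by
  induction h with
  | refl => exact fun i hi => hi
  | son hs _ ih =>
    intro i hi
    cases hu with
    | leaf => simp at hs
    | internal _ _ _ hl _ hv =>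
      have := ih (hv _ hs) i hi
      simp only [label]
      rw [hl, h2_mem_foldr]
      exact ⟨_, hs, this⟩

theorem h2_sum_zero {A M : Type*} [AddCommMonoid M] (l : List A) (f : A → M)
    (h : ∀ a ∈ l, f a = 0) : (l.map f).sum = 0 := by
  apply List.sum_eq_zero
  intro x hx
  obtain ⟨a, ha, rfl⟩ := List.mem_map.1 hx
  exact h a ha

theorem h2_sum_single (sons : List (CTree K))
    (hp : sons.Pairwise (fun a b => Disjoint a.label b.label))
    (i : K) (f : CTree K → ℂ) (hf : ∀ d ∈ sons, i ∉ d.label → f d = 0)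
    (d₀ : CTree K) (hd : d₀ ∈ sons) (hi : i ∈ d₀.label) :
    (sons.map f).sum = f d₀ := by
  induction sons with
  | nil => simp at hd
  | cons a l ih =>
    rw [List.pairwise_cons] at hp
    rw [List.map_cons, List.sum_cons]
    rcases List.mem_cons.1 hd with rfl | hd'
    · rw [h2_sum_zero, add_zero]
      intro d hdl
      exact hf d (List.mem_cons_of_mem _ hdl)
        (fun h => Finset.disjoint_left.1 (hp.1 d hdl) hi h)
    · rw [ih hp.2 (fun d hdl => hf d (List.mem_cons_of_mem _ hdl)) hd',
        hf a List.mem_cons_self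
          (fun h => Finset.disjoint_left.1 (hp.1 d₀ hd') h hi), zero_add]

theorem h2_nest {k : ℕ} (T : CTree K)
    (V : CTree K → Matrix K (Fin k) ℂ) (E : CTree K → Matrix (Fin k) (Fin k) ℂ)
    (hsupp : ∀ u : CTree K, u.Subtree T → ∀ i ∉ u.label, ∀ j : Fin k, V u i j = 0)
    (hnest : ∀ u : CTree K, u.Subtree T → ∀ u' ∈ u.sonsOf,
      ∀ i ∈ u'.label, ∀ j : Fin k, V u i j = (V u' * E u') i j)
    (l : Finset K) (sons : List (CTree K))
    (hl : l = sons.foldr (fun s acc => s.label ∪ acc) ∅)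
    (hp : sons.Pairwise (fun a b => Disjoint a.label b.label))
    (hu : (node l sons).Subtree T) (i : K) (j : Fin k) :
    (sons.map (fun d => (V d * E d) i j)).sum = V (node l sons) i j := by
  have hz : ∀ d ∈ sons, i ∉ d.label → (V d * E d) i j = 0 := by
    intro d hd hi
    rw [Matrix.mul_apply]
    apply Finset.sum_eq_zero
    intro m _
    rw [hsupp d (h2_sub_trans (Subtree.son hd (Subtree.refl d)) hu) i hi, zero_mul]
  by_cases h : ∃ d ∈ sons, i ∈ d.label
  · obtain ⟨d, hd, hi⟩ := h
    rw [h2_sum_single sons hp i _ hz d hd hi]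
    exact (hnest _ hu d hd i hi j).symm
  · rw [h2_sum_zero _ _ (fun d hd => hz d hd (fun hi => h ⟨d, hd, hi⟩))]
    rw [hsupp _ hu]
    simp only [label]
    rw [hl, h2_mem_foldr]
    exact h

theorem h2_list_finset_sum {A B : Type*} (l : List A) (s : Finset B) (f : A → B → ℂ) :
    (l.map (fun a => ∑ b ∈ s, f a b)).sum = ∑ b ∈ s, (l.map (fun a => f a b)).sum := by
  induction l with
  | nil => simp
  | cons a l ih => simp [ih, Finset.sum_add_distrib]

theorem h2_list_sum_comm {A B : Type*} (l : List A) (l' : List B) (f : A → B → ℂ) :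
    (l.map (fun a => (l'.map (fun b => f a b)).sum)).sum
      = (l'.map (fun b => (l.map (fun a => f a b)).sum)).sum := by
  induction l with
  | nil => simp
  | cons a l ih => simp [ih, List.sum_map_add]

theorem h2_list_sum_apply {A B : Type*} (l : List A) (f : A → B → ℂ) (j : B) :
    (l.map f).sum j = (l.map (fun a => f a j)).sum := by
  induction l with
  | nil => simp
  | cons a l ih => simp [ih]

theorem h2_mulVec_list_sum {A m n : Type*} [Fintype n] (M : Matrix m n ℂ)
    (l : List A) (f : A → n → ℂ) :
    M.mulVec (l.map f).sum = (l.map (fun a => M.mulVec (f a))).sum := by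
  induction l with
  | nil => simp
  | cons a l ih => simp [ih, Matrix.mulVec_add]

variable [Fintype K]

theorem h2_forward {k : ℕ} (T : CTree K)
    (W : CTree K → Matrix K (Fin k) ℂ) (E : CTree K → Matrix (Fin k) (Fin k) ℂ)
    (hsupp : ∀ u : CTree K, u.Subtree T → ∀ i ∉ u.label, ∀ j : Fin k, W u i j = 0)
    (hnest : ∀ u : CTree K, u.Subtree T → ∀ u' ∈ u.sonsOf,
      ∀ i ∈ u'.label, ∀ j : Fin k, W u i j = (W u' * E u') i j)
    (x : K → ℂ) (u : CTree K) (hv : u.Valid) (hu : u.Subtree T) :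
    forward W E x u = (W u).conjTranspose.mulVec x := by
  induction hv with
  | leaf l =>
    funext j
    rw [forward]
    simp only [Matrix.mulVec, dotProduct, Matrix.conjTranspose_apply]
    apply Finset.sum_congr rfl
    intro i _
    by_cases hi : i ∈ l
    · simp [hi]
    · rw [hsupp _ hu i hi j]; simp
  | internal l sons hne hl hp hval ih =>
    have hson : ∀ d ∈ sons, d.Subtree T := fun d hd =>
      h2_sub_trans (Subtree.son hd (Subtree.refl d)) hu
    have hN := h2_nest T W E hsupp hnest l sons hl hp hu
    have hF : forward W E x (node l sons)
        = (sons.map (fun d => (E d).conjTranspose.mulVec (forward W E x d))).sum := by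
      cases sons with
      | nil => exact absurd rfl hne
      | cons s ss =>
        rw [forward]
        exact congrArg List.sum (List.attach_map_val
          (f := fun d => (E d).conjTranspose.mulVec (forward W E x d)))
    rw [hF]
    have hM : sons.map (fun d => (E d).conjTranspose.mulVec (forward W E x d))
        = sons.map (fun d => (W d * E d).conjTranspose.mulVec x) := by
      apply List.map_congr_left
      intro d hd
      rw [ih d hd (hson d hd), Matrix.mulVec_mulVec, Matrix.conjTranspose_mul]
    rw [hM]
    funext j
    rw [h2_list_sum_apply]
    simp only [Matrix.mulVec, dotProduct, Matrix.conjTranspose_apply]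
    rw [h2_list_finset_sum]
    apply Finset.sum_congr rfl
    intro i _
    rw [← hN i j, List.sum_map_mul_right]
    congr 1
    have := map_list_sum (starRingEnd ℂ) (sons.map (fun d => (W d * E d) i j))
    rw [List.map_map] at this
    exact this.symm

theorem h2_backward {k : ℕ} {A : Type*} (T : CTree K)
    (V : CTree K → Matrix K (Fin k) ℂ) (E : CTree K → Matrix (Fin k) (Fin k) ℂ)
    (hsupp : ∀ u : CTree K, u.Subtree T → ∀ i ∉ u.label, ∀ j : Fin k, V u i j = 0)
    (hnest : ∀ u : CTree K, u.Subtree T → ∀ u' ∈ u.sonsOf,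
      ∀ i ∈ u'.label, ∀ j : Fin k, V u i j = (V u' * E u') i j)
    (L : List A) (p : A → CTree K) (z : A → Fin k → ℂ)
    (yhat : CTree K → Fin k → ℂ)
    (hy : ∀ t, yhat t = (L.map (fun b => if p b = t then z b else 0)).sum)
    (i : K) (u : CTree K) (hv : u.Valid) (hu : u.Subtree T) (c : Fin k → ℂ) :
    backward V E yhat u (yhat u + c) i
      = (V u).mulVec c i
        + (L.map (fun b => if (p b).Subtree u then (V (p b)).mulVec (z b) i else 0)).sum := by
  have hVy : ∀ t, (V t).mulVec (yhat t) i
      = (L.map (fun b => if p b = t then (V (p b)).mulVec (z b) i else 0)).sum := by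
    intro t
    rw [hy, h2_mulVec_list_sum, h2_list_sum_apply]
    congr 1
    apply List.map_congr_left
    intro b _
    by_cases h : p b = t
    · simp [h]
    · simp [h]
  induction hv generalizing c with
  | leaf l =>
    rw [backward, Matrix.mulVec_add, Pi.add_apply, hVy, add_comm]
    congr 2
    apply List.map_congr_left
    intro b _
    have : p b = node l [] ↔ (p b).Subtree (node l []) := by
      constructor
      · intro h; rw [h]; exact Subtree.refl _
      · intro h
        generalize p b = q at h
        cases h with
        | refl => rfl
        | son hs _ => simp at hs
    simp only [this]
  | internal l sons hne hl hp hval ih =>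
    have hson : ∀ d ∈ sons, d.Subtree T := fun d hd =>
      h2_sub_trans (Subtree.son hd (Subtree.refl d)) hu
    have hN := h2_nest T V E hsupp hnest l sons hl hp hu
    have hF : ∀ c, backward V E yhat (node l sons) c
        = (sons.map (fun d => backward V E yhat d (yhat d + (E d).mulVec c))).sum := by
      intro c
      cases sons with
      | nil => exact absurd rfl hne
      | cons s ss =>
        rw [backward]
        exact congrArg List.sum (List.attach_map_val
          (f := fun d => backward V E yhat d (yhat d + (E d).mulVec c)))
    rw [hF, h2_list_sum_apply]
    generalize hc' : yhat (node l sons) + c = c'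
    have hM : sons.map (fun d => backward V E yhat d (yhat d + (E d).mulVec c') i)
        = sons.map (fun d => (V d * E d).mulVec c' i
          + (L.map (fun b => if (p b).Subtree d
              then (V (p b)).mulVec (z b) i else 0)).sum) := by
      apply List.map_congr_left
      intro d hd
      rw [ih d hd (hson d hd), Matrix.mulVec_mulVec]
    rw [hM, List.sum_map_add, h2_list_sum_comm]
    have h1 : (sons.map (fun d => (V d * E d).mulVec c' i)).sum
        = (V (node l sons)).mulVec c' i := by
      simp only [Matrix.mulVec, dotProduct]
      rw [h2_list_finset_sum]
      apply Finset.sum_congr rfl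
      intro j _
      rw [← hN i j, List.sum_map_mul_right]
    rw [h1, ← hc', Matrix.mulVec_add, Pi.add_apply, hVy, add_comm (List.sum _), add_assoc,
      ← List.sum_map_add]
    congr 2
    apply List.map_congr_left
    intro b _
    have hzero : (p b).Subtree T → i ∉ (p b).label → (V (p b)).mulVec (z b) i = 0 := by
      intro hb hi
      simp only [Matrix.mulVec, dotProduct]
      apply Finset.sum_eq_zero
      intro j _
      rw [hsupp _ hb i hi, zero_mul]
    generalize (V (p b)).mulVec (z b) i = v at hzero
    generalize p b = q at hzero
    have hnot : ∀ d ∈ sons, (node l sons).Subtree d → False := by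
      intro d hd h
      have h1 := h2_sub_sizeOf h
      have h2 := List.sizeOf_lt_of_mem hd
      simp at h1
      omega
    by_cases hq : q.Subtree (node l sons)
    · by_cases hi : i ∈ q.label
      · rw [if_pos hq]
        cases hq with
        | refl =>
          rw [if_pos rfl, h2_sum_zero, add_zero]
          intro d hd
          rw [if_neg (hnot d hd)]
        | son hs hqs =>
          rename_i s
          rw [h2_sum_single sons hp i _ _ s hs (h2_label_subset (hval s hs) hqs i hi),
            if_pos hqs, if_neg, zero_add]
          · rintro rfl
            exact hnot s hs hqs
          · intro d hd hid
            rw [if_neg]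
            exact fun h => hid (h2_label_subset (hval d hd) h i hi)
      · have hv0 := hzero (h2_sub_trans hq hu) hi
        subst hv0
        simp
    · rw [if_neg hq, if_neg, h2_sum_zero, zero_add]
      · intro d hd
        rw [if_neg]
        exact fun h => hq (Subtree.son hd h)
      · rintro rfl
        exact hq (Subtree.refl _)

end Helpers

open CTree in
/-- Correctness of the `H²`-matrix–vector multiplication algorithm: if `G` agrees with
`V_t S_b W_s*` on every admissible leaf block `b = (t, s)` of the block-tree partition
and with its stored dense blocks on inadmissible leaves, then the composition of the
forward transformation, the multiplication phase (`ŷ_t += α S_b x̂_s` on admissible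
leaves, `y|_t̂ += α G|_{t̂×ŝ} x|_ŝ` on inadmissible leaves) and the backward
transformation computes `y + α G x`. -/
theorem h2_matvec_correct {I : Type} [DecidableEq I] [Fintype I]
    {J : Type} [DecidableEq J] [Fintype J] {k : ℕ}
    (TI : CTree I) (TJ : CTree J) (hTI : TI.Valid) (hTJ : TJ.Valid)
    (hrootI : TI.label = Finset.univ) (hrootJ : TJ.label = Finset.univ)
    -- `L` is the list of leaves of the block tree, each block `b = (t, s)` flagged
    -- by `true` if admissible; the leaf labels partition `I × J`:
    (L : List (CTree I × CTree J × Bool))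
    (hpart : ∀ p : I × J,
      (L.map (fun b => if p.1 ∈ b.1.label ∧ p.2 ∈ b.2.1.label
        then (1 : ℕ) else 0)).sum = 1)
    (hsub : ∀ b ∈ L, b.1.Subtree TI ∧ b.2.1.Subtree TJ)
    (V : CTree I → Matrix I (Fin k) ℂ) (EV : CTree I → Matrix (Fin k) (Fin k) ℂ)
    (W : CTree J → Matrix J (Fin k) ℂ) (EW : CTree J → Matrix (Fin k) (Fin k) ℂ)
    (S : CTree I → CTree J → Matrix (Fin k) (Fin k) ℂ)
    (hVsupp : ∀ u : CTree I, u.Subtree TI → ∀ i ∉ u.label, ∀ j : Fin k, V u i j = 0)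
    (hVnest : ∀ u : CTree I, u.Subtree TI → ∀ u' ∈ u.sonsOf,
      ∀ i ∈ u'.label, ∀ j : Fin k, V u i j = (V u' * EV u') i j)
    (hWsupp : ∀ u : CTree J, u.Subtree TJ → ∀ i ∉ u.label, ∀ j : Fin k, W u i j = 0)
    (hWnest : ∀ u : CTree J, u.Subtree TJ → ∀ u' ∈ u.sonsOf,
      ∀ i ∈ u'.label, ∀ j : Fin k, W u i j = (W u' * EW u') i j)
    (G : Matrix I J ℂ)
    (hadm : ∀ b ∈ L, b.2.2 = true → ∀ i ∈ b.1.label, ∀ j ∈ b.2.1.label,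
      G i j = (V b.1 * S b.1 b.2.1 * (W b.2.1).conjTranspose) i j)
    (α : ℂ) (x : J → ℂ) (y : I → ℂ) :
    (fun i => y i
        + (L.map (fun b => if b.2.2 = false ∧ i ∈ b.1.label
            then ∑ j ∈ b.2.1.label, α * G i j * x j else 0)).sum
        + backward V EV (yhatOf L S (forward W EW x) α) TI
            (yhatOf L S (forward W EW x) α TI) i)
      = fun i => y i + α * G.mulVec x i := by
  funext i
  have hfw : ∀ b ∈ L, forward W EW x b.2.1 = (W b.2.1).conjTranspose.mulVec x := fun b hb =>
    h2_forward TJ W EW hWsupp hWnest x b.2.1 (h2_sub_valid hTJ (hsub b hb).2) (hsub b hb).2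
  have hb := h2_backward TI V EV hVsupp hVnest L (fun b => b.1)
    (fun b => if b.2.2 = true then α • (S b.1 b.2.1).mulVec (forward W EW x b.2.1) else 0)
    (yhatOf L S (forward W EW x) α)
    (by
      intro t
      rw [yhatOf]
      congr 1
      apply List.map_congr_left
      intro b _
      by_cases h1 : b.1 = t <;> by_cases h2 : b.2.2 = true <;> simp [h1, h2])
    i TI hTI (Subtree.refl _) 0
  rw [add_zero, Matrix.mulVec_zero, Pi.zero_apply, zero_add] at hb
  rw [hb, add_assoc, ← List.sum_map_add]
  congr 1
  have hterm : ∀ b ∈ L,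
      ((if b.2.2 = false ∧ i ∈ b.1.label
          then ∑ j ∈ b.2.1.label, α * G i j * x j else 0)
        + (if b.1.Subtree TI then (V b.1).mulVec (if b.2.2 = true
            then α • (S b.1 b.2.1).mulVec (forward W EW x b.2.1) else 0) i else 0))
      = ∑ j, ((if i ∈ b.1.label ∧ j ∈ b.2.1.label then (1 : ℕ) else 0 : ℕ) : ℂ)
          * (α * G i j * x j) := by
    intro b hbL
    rw [if_pos (hsub b hbL).1, hfw b hbL]
    cases hflag : b.2.2 with
    | false =>
      by_cases hi : i ∈ b.1.label
      · simp [hi, Finset.sum_ite_mem]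
      · simp [hi]
    | true =>
      simp only [if_true, Bool.true_eq_false, false_and, if_false, zero_add]
      rw [Matrix.mulVec_smul, Matrix.mulVec_mulVec, Matrix.mulVec_mulVec, Pi.smul_apply,
        smul_eq_mul, Matrix.mulVec, dotProduct, Finset.mul_sum]
      apply Finset.sum_congr rfl
      intro j _
      by_cases hi : i ∈ b.1.label
      · by_cases hj : j ∈ b.2.1.label
        · rw [← hadm b hbL hflag i hi j hj]
          simp [hi, hj, mul_assoc]
        · have : (V b.1 * S b.1 b.2.1 * (W b.2.1).conjTranspose) i j = 0 := by
            rw [Matrix.mul_apply]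
            apply Finset.sum_eq_zero
            intro m _
            rw [Matrix.conjTranspose_apply, hWsupp _ (hsub b hbL).2 j hj, star_zero, mul_zero]
          rw [this]
          simp [hj]
      · have : (V b.1 * S b.1 b.2.1 * (W b.2.1).conjTranspose) i j = 0 := by
          rw [Matrix.mul_assoc, Matrix.mul_apply]
          apply Finset.sum_eq_zero
          intro m _
          rw [hVsupp _ (hsub b hbL).1 i hi, zero_mul]
        rw [this]
        simp [hi]
  rw [List.map_congr_left hterm, h2_list_finset_sum, Matrix.mulVec, dotProduct, Finset.mul_sum]
  apply Finset.sum_congr rfl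
  intro j _
  rw [List.sum_map_mul_right]
  have h1 := congrArg (Nat.cast : ℕ → ℂ) (hpart (i, j))
  rw [Nat.cast_list_sum, List.map_map, Nat.cast_one] at h1
  have h2 : (L.map (fun b => ((if i ∈ b.1.label ∧ j ∈ b.2.1.label
      then (1 : ℕ) else 0 : ℕ) : ℂ))).sum = 1 := by
    rw [← h1]
    rfl
  rw [h2]
  ring
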